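/- Transitive subsumption: for every consistent assignment A (A+ ∩ A− = ∅), grounder memory G, non-ground safe rule r, and parameters k_co, k_ru ≥ 0, if the default grounding strategy yields s_def(A, G, r) = (G′, R) and the k-unassigned accumulator grounding strategy yields ŝ_{k_co,k_ru}(A, G, r) = (G″, R′), then R ⊆ R′. -/

import Mathlib

/-! Basic syntax: terms, atoms, rules -/

inductive Term (Va Co : Type) where
  | var (v : Va)
  | const (c : Co)
deriving DecidableEq

structure Atom (Pr Va Co : Type) where
  pred : Pr
  args : List (Term Va Co)
deriving DecidableEq

/-- A normal rule: head with at most one atom, positive and negative body. -/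
structure Rule (Pr Va Co : Type) where
  head : Option (Atom Pr Va Co)
  pos : Finset (Atom Pr Va Co)
  neg : Finset (Atom Pr Va Co)
deriving DecidableEq

variable {Pr Va Co : Type} [DecidableEq Pr] [DecidableEq Va] [DecidableEq Co]

def Term.vars : Term Va Co → Set Va
  | .var v => {v}
  | .const _ => ∅

def Atom.vars (a : Atom Pr Va Co) : Set Va := ⋃ t ∈ a.args, t.vars

/-- Variables of a set of atoms. -/
def atomsVars (S : Set (Atom Pr Va Co)) : Set Va := ⋃ a ∈ S, a.vars

def Rule.vars (r : Rule Pr Va Co) : Set Va :=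
  (r.head.elim ∅ Atom.vars) ∪ atomsVars (r.pos : Set (Atom Pr Va Co)) ∪
    atomsVars (r.neg : Set (Atom Pr Va Co))

def Rule.IsGround (r : Rule Pr Va Co) : Prop := r.vars = ∅

/-- Safety: every variable of the rule occurs in its positive body. -/
def Rule.Safe (r : Rule Pr Va Co) : Prop := r.vars ⊆ atomsVars (r.pos : Set (Atom Pr Va Co))

/-! Substitutions and grounding -/

abbrev Subst (Va Co : Type) := Va → Term Va Co

def Term.subst (σ : Subst Va Co) : Term Va Co → Term Va Co
  | .var v => σ v
  | .const c => .const c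

def Atom.subst (σ : Subst Va Co) (a : Atom Pr Va Co) : Atom Pr Va Co :=
  ⟨a.pred, a.args.map (Term.subst σ)⟩

def Rule.subst (σ : Subst Va Co) (r : Rule Pr Va Co) : Rule Pr Va Co :=
  ⟨r.head.map (Atom.subst σ), r.pos.image (Atom.subst σ), r.neg.image (Atom.subst σ)⟩

/-- `σ` is a (grounding) substitution for all variables in `S`. -/
def GroundsAll (σ : Subst Va Co) (S : Set Va) : Prop :=
  ∀ v ∈ S, ∃ c, σ v = Term.const c

/-- Ground instances of a rule. -/
def grd (r : Rule Pr Va Co) : Set (Rule Pr Va Co) :=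
  { r' | ∃ σ : Subst Va Co, GroundsAll σ r.vars ∧ r' = r.subst σ }

/-- Ground instances of a program. -/
def grdP (P : Finset (Rule Pr Va Co)) : Set (Rule Pr Va Co) :=
  ⋃ r ∈ P, grd r

/-! Assignments -/

structure Assignment (Pr Va Co : Type) where
  pos : Set (Atom Pr Va Co)
  neg : Set (Atom Pr Va Co)

/-- Combination `A ⊎ A'` of two assignments. -/
def Assignment.combine (A B : Assignment Pr Va Co) : Assignment Pr Va Co :=
  ⟨A.pos ∪ B.pos, A.neg ∪ B.neg⟩

/-- A grounder memory identified with a fully positive assignment. -/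
def memAssign (G : Set (Atom Pr Va Co)) : Assignment Pr Va Co := ⟨G, ∅⟩

/-- A ground rule is of interest w.r.t. `A` if its positive body is contained in `A⁺`. -/
def OfInterest (r : Rule Pr Va Co) (A : Assignment Pr Va Co) : Prop :=
  ↑r.pos ⊆ A.pos

/-- `a` occurs as a fact (rule with empty body) of `P`. -/
def IsFactOf (P : Finset (Rule Pr Va Co)) (a : Atom Pr Va Co) : Prop :=
  ∃ f ∈ P, f.pos = ∅ ∧ f.neg = ∅ ∧ f.head = some a

/-- A ground rule is inactive (w.r.t. program `P`). -/
def Inactive (P : Finset (Rule Pr Va Co)) (r : Rule Pr Va Co) : Prop :=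
  (∃ a ∈ r.pos, ∀ p ∈ P, ∀ h, p.head = some h → h.pred ≠ a.pred) ∨
  (∃ a ∈ r.neg, IsFactOf P a)

/-- Weak applicability of a ground rule w.r.t. an assignment. -/
def WeaklyApplicable (P : Finset (Rule Pr Va Co)) (r : Rule Pr Va Co)
    (A : Assignment Pr Va Co) : Prop :=
  ↑r.pos ∩ A.neg = (∅ : Set (Atom Pr Va Co)) ∧ ¬ Inactive P r

/-- The assigned literals `L_A` of the ground instance `rσ` w.r.t. `A`. -/
def assignedLits (r : Rule Pr Va Co) (σ : Subst Va Co) (A : Assignment Pr Va Co) :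
    Set (Atom Pr Va Co) :=
  { l | l ∈ r.pos ∧ l.subst σ ∈ A.pos }

/-- `rσ` is all-variable-assigning w.r.t. `A`. -/
def AllVarAssigning (r : Rule Pr Va Co) (σ : Subst Va Co) (A : Assignment Pr Va Co) : Prop :=
  atomsVars (assignedLits r σ A) = r.vars

/-- The ground instance `rσ` is `k`-unassigned w.r.t. `A`. -/
def KUnassigned (P : Finset (Rule Pr Va Co)) (r : Rule Pr Va Co) (σ : Subst Va Co)
    (A : Assignment Pr Va Co) (k : ℕ) : Prop :=
  WeaklyApplicable P (r.subst σ) A ∧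
  AllVarAssigning r σ A ∧
  (↑r.pos \ assignedLits r σ A).ncard ≤ k

/-! Lazy-grounding strategies -/

/-- The default grounding strategy `s_def`. -/
def defaultStrategy (P : Finset (Rule Pr Va Co)) (A : Assignment Pr Va Co)
    (G : Set (Atom Pr Va Co)) (r : Rule Pr Va Co) :
    Set (Atom Pr Va Co) × Set (Rule Pr Va Co) :=
  (A.pos, { r' ∈ grd r | ¬ Inactive P r' ∧ OfInterest r' A })

/-- Ground rules produced by the `k`-unassigned condition w.r.t. an assignment. -/
def kUnassignedSet (P : Finset (Rule Pr Va Co)) (kco kru : ℕ) (r : Rule Pr Va Co)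
    (A : Assignment Pr Va Co) : Set (Rule Pr Va Co) :=
  { r' | ∃ σ : Subst Va Co, GroundsAll σ r.vars ∧ r' = r.subst σ ∧
      r'.head = none ∧ KUnassigned P r σ A kco } ∪
  { r' | ∃ σ : Subst Va Co, GroundsAll σ r.vars ∧ r' = r.subst σ ∧
      r'.head ≠ none ∧ KUnassigned P r σ A kru }

/-- The `k`-unassigned grounding strategy `s_{k_co,k_ru}`. -/
def kUnassignedStrategy (P : Finset (Rule Pr Va Co)) (kco kru : ℕ)
    (A : Assignment Pr Va Co) (G : Set (Atom Pr Va Co)) (r : Rule Pr Va Co) :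
    Set (Atom Pr Va Co) × Set (Rule Pr Va Co) :=
  (A.pos, kUnassignedSet P kco kru r A)

/-- The default accumulator grounding strategy `ŝ_def`. -/
def defaultAccumStrategy (P : Finset (Rule Pr Va Co)) (A : Assignment Pr Va Co)
    (G : Set (Atom Pr Va Co)) (r : Rule Pr Va Co) :
    Set (Atom Pr Va Co) × Set (Rule Pr Va Co) :=
  (G ∪ A.pos,
   { r' ∈ grd r | ¬ Inactive P r' ∧ OfInterest r' ((memAssign (G ∪ A.pos)).combine A) })

/-- The `k`-unassigned accumulator grounding strategy `ŝ_{k_co,k_ru}`. -/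
def kUnassignedAccumStrategy (P : Finset (Rule Pr Va Co)) (kco kru : ℕ)
    (A : Assignment Pr Va Co) (G : Set (Atom Pr Va Co)) (r : Rule Pr Va Co) :
    Set (Atom Pr Va Co) × Set (Rule Pr Va Co) :=
  (G ∪ A.pos, kUnassignedSet P kco kru r ((memAssign (G ∪ A.pos)).combine A))

/-! Semantics: models, FLP reduct, answer sets -/

/-- `I ⊨ r`: if the body holds then the head is nonempty and true. -/
def Satisfies (I : Set (Atom Pr Va Co)) (r : Rule Pr Va Co) : Prop :=
  (↑r.pos ⊆ I ∧ ↑r.neg ∩ I = ∅) → ∃ h, r.head = some h ∧ h ∈ I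

def IsModel (I : Set (Atom Pr Va Co)) (Q : Set (Rule Pr Va Co)) : Prop :=
  ∀ r ∈ Q, Satisfies I r

/-- The FLP-reduct `Q^I`. -/
def Reduct (Q : Set (Rule Pr Va Co)) (I : Set (Atom Pr Va Co)) : Set (Rule Pr Va Co) :=
  { r ∈ Q | ↑r.pos ⊆ I ∧ ↑r.neg ∩ I = ∅ }

/-- `I` is an answer set of `Q`: a subset-minimal model of the reduct `Q^I`. -/
def IsAnswerSet (I : Set (Atom Pr Va Co)) (Q : Set (Rule Pr Va Co)) : Prop :=
  IsModel I (Reduct Q I) ∧ ∀ J ⊆ I, IsModel J (Reduct Q I) → J = I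

theorem assignedLits_eq_pos {r : Rule Pr Va Co} {σ : Subst Va Co} {A : Assignment Pr Va Co}
    (h : OfInterest (r.subst σ) A) :
    assignedLits r σ A = (r.pos : Set (Atom Pr Va Co)) :=
  Set.Subset.antisymm (fun _ hl => hl.1)
    (fun _ hl => ⟨hl, h (Finset.mem_image_of_mem (Atom.subst σ) hl)⟩)

theorem Rule.Safe.atomsVars_pos {r : Rule Pr Va Co} (h : r.Safe) :
    atomsVars (r.pos : Set (Atom Pr Va Co)) = r.vars :=
  Set.Subset.antisymm (fun _ hv => Or.inl (Or.inr hv)) h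

/-- An active ground instance of a safe rule whose positive body is true, and hence not false,
is `k`-unassigned for every `k`. -/
theorem OfInterest.kUnassigned {P : Finset (Rule Pr Va Co)} {r : Rule Pr Va Co}
    {σ : Subst Va Co} {A : Assignment Pr Va Co} (h : OfInterest (r.subst σ) A)
    (hsafe : r.Safe) (hact : ¬ Inactive P (r.subst σ))
    (hneg : ((r.subst σ).pos : Set (Atom Pr Va Co)) ∩ A.neg = ∅) (k : ℕ) :
    KUnassigned P r σ A k := by
  refine ⟨⟨hneg, hact⟩, ?_, ?_⟩
  · rw [AllVarAssigning, assignedLits_eq_pos h, hsafe.atomsVars_pos]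
  · simp [assignedLits_eq_pos h]

/-- Transitive subsumption: every `k`-unassigned accumulator grounding
strategy subsumes the default grounding strategy (for consistent assignments). -/
theorem default_subsumed_by_kUnassignedAccum
    {Pr Va Co : Type} [DecidableEq Pr] [DecidableEq Va] [DecidableEq Co]
    (P : Finset (Rule Pr Va Co)) (A : Assignment Pr Va Co) (G : Set (Atom Pr Va Co))
    (r : Rule Pr Va Co) (hsafe : r.Safe) (hng : ¬ r.IsGround)
    (kco kru : ℕ) (hcons : A.pos ∩ A.neg = ∅)
    (G' G'' : Set (Atom Pr Va Co)) (R R' : Set (Rule Pr Va Co))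
    (h1 : defaultStrategy P A G r = (G', R))
    (h2 : kUnassignedAccumStrategy P kco kru A G r = (G'', R')) :
    R ⊆ R' := by
  obtain rfl : _ = R := congrArg Prod.snd h1
  obtain rfl : _ = R' := congrArg Prod.snd h2
  rintro _ ⟨⟨σ, hσ, rfl⟩, hact, hint⟩
  have hint' : OfInterest (r.subst σ) ((memAssign (G ∪ A.pos)).combine A) :=
    fun _ ha => Or.inr (hint ha)
  have hneg : ((r.subst σ).pos : Set (Atom Pr Va Co)) ∩
      ((memAssign (G ∪ A.pos)).combine A).neg = ∅ := by
    rw [Assignment.combine, memAssign, Set.empty_union]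
    exact Set.subset_empty_iff.mp (hcons ▸ Set.inter_subset_inter_left _ hint)
  have hk := hint'.kUnassigned hsafe hact hneg
  by_cases hh : (r.subst σ).head = none
  · exact Or.inl ⟨σ, hσ, rfl, hh, hk kco⟩
  · exact Or.inr ⟨σ, hσ, rfl, hh, hk kru⟩
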